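/- Let L be a finite-dimensional p-nilpotent restricted Lie algebra over a perfect field F of characteristic p > 0, with chosen elements e₁,…,e_n, set X of representatives, and subspace E of u(L) as in the context. Then: (1) ω(L) = L + E; (2) (L + J_L) ∩ E = J_L = E ∩ L'_p u(L); (3) ω(L)/J_L = (L + J_L)/J_L ⊕ E/J_L as vector spaces. -/

import Mathlib

open UniversalEnvelopingAlgebra

attribute [local instance 100] LieRing.ofAssociativeRing

/-- A restricted Lie algebra over a field `F` of characteristic `p`: a Lie algebra equipped
with a `p`-map `x ↦ x^[p]` satisfying Jacobson's identities.  The additive identity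
`(x+y)^[p] = x^[p] + y^[p] + Σ sᵢ(x,y)` (with `sᵢ` the Jacobson polynomials) is expressed
faithfully inside the universal enveloping algebra, where it reads
`ι((x+y)^[p]) - ι(x^[p]) - ι(y^[p]) = (ι x + ι y)^p - (ι x)^p - (ι y)^p`. -/
class RestrictedLieAlgebra (p : ℕ) (F : Type*) (L : Type*) [Field F]
    [LieRing L] [LieAlgebra F L] : Type _ where
  pOp : L → L
  pOp_smul : ∀ (a : F) (x : L), pOp (a • x) = a ^ p • pOp x
  ad_pOp : ∀ x y : L, ⁅pOp x, y⁆ = ((LieAlgebra.ad F L x) ^ p) y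
  pOp_add : ∀ x y : L,
    ι F (pOp (x + y)) - ι F (pOp x) - ι F (pOp y)
      = (ι F x + ι F y) ^ p - (ι F x) ^ p - (ι F y) ^ p

namespace RestrictedLieAlgebra

variable (p : ℕ) (F : Type*) [Field F]

section Defs

variable (L : Type*) [LieRing L] [LieAlgebra F L] [RestrictedLieAlgebra p F L]

/-- The `p`-map of a restricted Lie algebra. -/
abbrev pmap (x : L) : L := RestrictedLieAlgebra.pOp (p := p) (F := F) x

/-- The relation defining the restricted enveloping algebra as a quotient of the
universal enveloping algebra: `x^p = x^[p]` for all `x ∈ L`. -/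
def uRel : UniversalEnvelopingAlgebra F L → UniversalEnvelopingAlgebra F L → Prop :=
  fun a b => ∃ x : L, a = (ι F x) ^ p ∧ b = ι F (pmap p F L x)

/-- The restricted enveloping algebra `u(L)`: the quotient of the universal enveloping
algebra of `L` by the two-sided ideal generated by `{x^p - x^[p] : x ∈ L}`. -/
abbrev uEnv := RingQuot (uRel p F L)

/-- The canonical (linear) embedding `L → u(L)`. -/
def uemb : L →ₗ[F] uEnv p F L :=
  ((RingQuot.mkAlgHom F (uRel p F L)).toLinearMap).comp (ι F : L →ₗ⁅F⁆ _).toLinearMap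

variable [Fact p.Prime]

/-- The augmentation map `ε : u(L) → F`, induced by `x ↦ 0` for `x ∈ L`. -/
noncomputable def aug : uEnv p F L →ₐ[F] F :=
  RingQuot.liftAlgHom F
    ⟨(UniversalEnvelopingAlgebra.lift F) (0 : L →ₗ⁅F⁆ F), by
      rintro a b ⟨x, rfl, rfl⟩
      simp [UniversalEnvelopingAlgebra.lift_ι_apply,
        zero_pow (Nat.Prime.ne_zero (Fact.out : p.Prime))]⟩

/-- The augmentation ideal `ω(L)`, i.e. the kernel of the augmentation map, as a
subspace of `u(L)`. -/
noncomputable def omegaIdeal : Submodule F (uEnv p F L) :=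
  LinearMap.ker (aug p F L).toLinearMap

/-- The image of `L` inside `u(L)`. -/
def lSub : Submodule F (uEnv p F L) := LinearMap.range (uemb p F L)

end Defs

section Closure

variable {L : Type*} [LieRing L] [LieAlgebra F L] [RestrictedLieAlgebra p F L]

/-- The restricted subalgebra generated by a subset `S` of `L`: the smallest Lie
subalgebra containing `S` which is closed under the `p`-map. -/
def restrictedClosure (S : Set L) : LieSubalgebra F L :=
  sInf {K : LieSubalgebra F L | S ⊆ K ∧ ∀ x ∈ K, pmap p F L x ∈ K}

/-- For a subalgebra `N ⊆ L`, the restricted subalgebra `N^p` generated by all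
`x^[p]`, `x ∈ N`. -/
def subPPow (K : LieSubalgebra F L) : LieSubalgebra F L :=
  restrictedClosure p F (pmap p F L '' K)

end Closure

section PNilpotent

variable (L : Type*) [LieRing L] [LieAlgebra F L] [RestrictedLieAlgebra p F L]

/-- `L` is `p`-nilpotent if `L^{pˢ} = 0` for some `s`, where `L^p` denotes the restricted
subalgebra generated by all `x^[p]`. -/
def IsPNilpotent : Prop :=
  ∃ s : ℕ, (subPPow p F)^[s] (⊤ : LieSubalgebra F L) = ⊥

/-- The derived subalgebra `L' = γ₂(L)` as a submodule of `L`. -/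
abbrev derivedSub : Submodule F L := (LieModule.lowerCentralSeries F L L 1).toSubmodule

/-- `L'_p`, the restricted subalgebra generated by `L'`, as a submodule. -/
def derivedP : Submodule F L :=
  (restrictedClosure p F (derivedSub F L : Set L)).toSubmodule

/-- `L'^p + γ₃(L)`, as a submodule of `L`. -/
def mainIdeal : Submodule F L :=
  (subPPow p F (restrictedClosure p F (derivedSub F L : Set L))).toSubmodule
    ⊔ (LieModule.lowerCentralSeries F L L 2).toSubmodule

end PNilpotent

end RestrictedLieAlgebra

namespace RestrictedLieAlgebra

section Setup

variable (p : ℕ) (F : Type*) [Field F] [Fact p.Prime]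
variable (L : Type*) [LieRing L] [LieAlgebra F L] [RestrictedLieAlgebra p F L]

/-- The ideal `J_L = ω(L)L' + L'ω(L)` of `u(L)`, as a subspace. -/
noncomputable def jIdeal : Submodule F (uEnv p F L) :=
  omegaIdeal p F L * ((derivedSub F L).map (uemb p F L))
    + ((derivedSub F L).map (uemb p F L)) * omegaIdeal p F L

/-- The subspace `E` of `u(L)`: the span of `J_L` together with all PBW monomials of
degree at least two in the fixed set `X` of representatives. -/
noncomputable def eSpace (n : ℕ) (ex : Fin n → ℕ) (X : (i : Fin n) → Fin (ex i) → L) :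
    Submodule F (uEnv p F L) :=
  jIdeal p F L ⊔
    Submodule.span F
      {u : uEnv p F L | ∃ a : (i : Fin n) → Fin (ex i) → ℕ,
        (∀ i j, a i j < p) ∧ 2 ≤ ∑ i, ∑ j, a i j ∧
        u = ((List.finRange n).map (fun i =>
              ((List.finRange (ex i)).map
                (fun j => uemb p F L (X i j) ^ a i j)).prod)).prod}

/-- The data `e₁, …, e_n ∈ L` together with exponents `ex i = exp(ēᵢ)` and a set `X` of
coset representatives, expressing the decomposition
`L/L'_p = ⟨ē₁⟩_p ⊕ ⋯ ⊕ ⟨ē_n⟩_p` via the resulting basis `ēᵢ^{[p]^j}` (`0 ≤ j < ex i`)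
of `L/L'_p`. -/
def GoodPresentation (n : ℕ) (e : Fin n → L) (ex : Fin n → ℕ)
    (X : (i : Fin n) → Fin (ex i) → L) : Prop :=
  LinearIndependent F
    (fun q : Σ i : Fin n, Fin (ex i) =>
      (Submodule.Quotient.mk ((pmap p F L)^[(q.2 : ℕ)] (e q.1)) : L ⧸ derivedP p F L)) ∧
  Submodule.span F
    (Set.range (fun q : Σ i : Fin n, Fin (ex i) =>
      (Submodule.Quotient.mk ((pmap p F L)^[(q.2 : ℕ)] (e q.1)) : L ⧸ derivedP p F L))) = ⊤ ∧
  (∀ i, (pmap p F L)^[ex i] (e i) ∈ derivedP p F L) ∧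
  (∀ i (j : Fin (ex i)), X i j - (pmap p F L)^[(j : ℕ)] (e i) ∈ derivedP p F L)

end Setup

end RestrictedLieAlgebra

namespace RestrictedLieAlgebra

section TruncatedPolynomials

variable {F : Type*} [Field F]

/-- A commutative algebra generated by elements `t i` with `t i ^ m i = 0` is spanned by the
truncated monomials in the `t i`. -/
theorem span_truncated_monomials_eq_top {A : Type*} [CommRing A] [Algebra F A] {n : ℕ}
    (t : Fin n → A) (m : Fin n → ℕ) (ht : ∀ i, t i ^ m i = 0)
    (hgen : Algebra.adjoin F (Set.range t) = ⊤) :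
    Submodule.span F (Set.range fun d : (i : Fin n) → Fin (m i) => ∏ i, t i ^ (d i : ℕ)) = ⊤ := by
  rw [eq_top_iff]
  rintro x -
  have hx : x ∈ Algebra.adjoin F (Set.range t) := hgen ▸ Algebra.mem_top
  rw [Algebra.adjoin_range_eq_range_aeval] at hx
  obtain ⟨f, rfl⟩ := hx
  induction f using MvPolynomial.induction_on' with
  | add f g hf hg =>
    simp only [map_add]
    exact add_mem hf hg
  | monomial d c =>
    simp only [AlgHom.toRingHom_eq_coe, RingHom.coe_coe, MvPolynomial.aeval_monomial,
      ← Algebra.smul_def]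
    refine Submodule.smul_mem _ _ ?_
    rw [Finsupp.prod_fintype _ _ fun i => pow_zero _]
    by_cases hd : ∀ i, d i < m i
    · exact Submodule.subset_span ⟨fun i => ⟨d i, hd i⟩, rfl⟩
    · push Not at hd
      obtain ⟨i, hi⟩ := hd
      have hzero : t i ^ d i = 0 := pow_eq_zero_of_le hi (ht i)
      rw [Finset.prod_eq_zero (Finset.mem_univ i) hzero]
      exact zero_mem _

/-- The ideal of the polynomial ring generated by the powers `X i ^ m i`. -/
noncomputable def truncIdeal (F : Type*) [Field F] {n : ℕ} (m : Fin n → ℕ) :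
    Ideal (MvPolynomial (Fin n) F) :=
  Ideal.span ((fun s => MvPolynomial.monomial s (1 : F)) ''
    Set.range fun i => Finsupp.single i (m i))

/-- The truncated polynomial algebra `F[X₁, …, X_n] / (X_i ^ m_i)`. -/
abbrev TruncPoly (F : Type*) [Field F] {n : ℕ} (m : Fin n → ℕ) : Type _ :=
  MvPolynomial (Fin n) F ⧸ truncIdeal F m

/-- The generators of the truncated polynomial algebra. -/
noncomputable def truncX (F : Type*) [Field F] {n : ℕ} (m : Fin n → ℕ) (i : Fin n) :
    TruncPoly F m :=
  Ideal.Quotient.mk _ (MvPolynomial.X i)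

theorem truncX_pow {n : ℕ} (m : Fin n → ℕ) (i : Fin n) : truncX F m i ^ m i = 0 := by
  rw [truncX, ← map_pow, Ideal.Quotient.eq_zero_iff_mem, MvPolynomial.X_pow_eq_monomial]
  exact Ideal.subset_span ⟨_, ⟨i, rfl⟩, rfl⟩

theorem linearIndependent_truncX_monomials {n : ℕ} (m : Fin n → ℕ) :
    LinearIndependent F
      fun d : (i : Fin n) → Fin (m i) => ∏ i, truncX F m i ^ (d i : ℕ) := by
  classical
  let code : ((i : Fin n) → Fin (m i)) → (Fin n →₀ ℕ) := fun d =>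
    Finsupp.equivFunOnFinite.symm fun i => (d i : ℕ)
  have hcode : Function.Injective code := fun d d' h => by
    funext i
    exact Fin.ext (DFunLike.congr_fun h i)
  have hprod : ∀ d : (i : Fin n) → Fin (m i), ∏ i, truncX F m i ^ (d i : ℕ)
      = Ideal.Quotient.mk (truncIdeal F m) (MvPolynomial.monomial (code d) 1) := fun d => by
    rw [MvPolynomial.monomial_eq, Finsupp.prod_fintype _ _ fun i => pow_zero _]
    simp [truncX, code]
  rw [Fintype.linearIndependent_iff]
  intro g hg d
  have hmem : ∑ d, MvPolynomial.monomial (code d) (g d) ∈ truncIdeal F m := by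
    rw [← Ideal.Quotient.eq_zero_iff_mem, map_sum, ← hg]
    refine Finset.sum_congr rfl fun d _ => ?_
    rw [hprod, ← Ideal.Quotient.mkₐ_eq_mk F, ← map_smul, MvPolynomial.smul_monomial, smul_eq_mul,
      mul_one]
  have hcoeff : MvPolynomial.coeff (code d) (∑ d, MvPolynomial.monomial (code d) (g d)) = g d := by
    rw [MvPolynomial.coeff_sum, Finset.sum_eq_single d]
    · simp
    · intro d' _ hd
      rw [MvPolynomial.coeff_monomial, if_neg fun h => hd (hcode h)]
    · simp
  by_contra hne
  rw [truncIdeal, MvPolynomial.mem_ideal_span_monomial_image] at hmem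
  obtain ⟨_, ⟨i, rfl⟩, hi⟩ := hmem (code d) (by rwa [MvPolynomial.mem_support_iff, hcoeff])
  have := hi i
  rw [Finsupp.single_eq_same] at this
  exact absurd (d i).isLt (not_lt.mpr this)

end TruncatedPolynomials

section Enveloping

variable (p : ℕ) (F : Type*) [Field F]
variable (L : Type*) [LieRing L] [LieAlgebra F L] [RestrictedLieAlgebra p F L]

theorem uemb_lie (x y : L) :
    uemb p F L ⁅x, y⁆
      = uemb p F L x * uemb p F L y - uemb p F L y * uemb p F L x := by
  simp only [uemb, LinearMap.comp_apply, LieHom.coe_toLinearMap, LieHom.map_lie,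
    LieRing.of_associative_ring_bracket, AlgHom.toLinearMap_apply, map_sub, map_mul]

theorem uemb_pmap (x : L) : uemb p F L (pmap p F L x) = uemb p F L x ^ p := by
  simp only [uemb, LinearMap.comp_apply, LieHom.coe_toLinearMap, AlgHom.toLinearMap_apply,
    ← map_pow]
  exact (RingQuot.mkAlgHom_rel F ⟨x, rfl, rfl⟩).symm

theorem uemb_pmap_iterate (x : L) (j : ℕ) :
    uemb p F L ((pmap p F L)^[j] x) = uemb p F L x ^ p ^ j := by
  induction j with
  | zero => simp
  | succ j ih => rw [Function.iterate_succ_apply', uemb_pmap, ih, ← pow_mul, pow_succ]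

theorem adjoin_range_uemb : Algebra.adjoin F (Set.range (uemb p F L)) = ⊤ := by
  have hs : Function.Surjective ((RingQuot.mkAlgHom F (uRel p F L)).comp
      (UniversalEnvelopingAlgebra.mkAlgHom F L)) :=
    (RingQuot.mkAlgHom_surjective F (uRel p F L)).comp (RingCon.mkₐ_surjective (α := F) _)
  rw [← AlgHom.range_eq_top] at hs
  rw [← hs, ← Algebra.map_top, ← TensorAlgebra.adjoin_range_ι, AlgHom.map_adjoin,
    ← Set.range_comp]
  rfl

variable {L}

theorem lie_mem_derivedSub (x y : L) : ⁅x, y⁆ ∈ derivedSub F L := by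
  rw [derivedSub, LieSubmodule.mem_toSubmodule, LieModule.lowerCentralSeries_succ]
  exact LieSubmodule.lie_mem_lie (LieSubmodule.mem_top x) (LieSubmodule.mem_top y)

theorem mem_derivedP_iff {x : L} :
    x ∈ derivedP p F L ↔ ∀ K : LieSubalgebra F L, derivedSub F L ≤ K.toSubmodule →
      (∀ y ∈ K, pmap p F L y ∈ K) → x ∈ K := by
  rw [derivedP, LieSubalgebra.mem_toSubmodule, restrictedClosure, ← SetLike.mem_coe,
    LieSubalgebra.coe_sInf]
  simp only [Set.mem_iInter, Set.mem_ofPred_eq, and_imp]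
  rfl

theorem derivedSub_le_derivedP : derivedSub F L ≤ derivedP p F L := fun _ hx =>
  (mem_derivedP_iff p F).mpr fun _ hK _ => hK hx

theorem pmap_mem_derivedP {x : L} (hx : x ∈ derivedP p F L) :
    pmap p F L x ∈ derivedP p F L :=
  (mem_derivedP_iff p F).mpr fun K hK hp => hp x ((mem_derivedP_iff p F).mp hx K hK hp)

theorem lie_mem_derivedP (x y : L) : ⁅x, y⁆ ∈ derivedP p F L :=
  derivedSub_le_derivedP p F (lie_mem_derivedSub F x y)

/-- The `p`-map is additive modulo `L'_p`. -/
theorem pmap_add_sub_mem_derivedP [Fact p.Prime] (x y : L) :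
    pmap p F L (x + y) - pmap p F L x - pmap p F L y ∈ derivedP p F L := by
  let V := L ⧸ derivedP p F L
  let _ : Module Fᵐᵒᵖ V := Module.compHom _ ((RingHom.id F).fromOpposite mul_comm)
  have : IsCentralScalar F V := ⟨fun _ _ => rfl⟩
  let f : L →ₗ⁅F⁆ TrivSqZeroExt F V :=
    { (TrivSqZeroExt.inrHom F V).comp (derivedP p F L).mkQ with
      map_lie' := fun {x y} => by
        have h : (derivedP p F L).mkQ ⁅x, y⁆ = 0 := by
          simpa using lie_mem_derivedP p F x y
        simp [h, LieRing.of_associative_ring_bracket, mul_comm] }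
  have hf : ∀ x, f x = TrivSqZeroExt.inr ((derivedP p F L).mkQ x) := fun _ => rfl
  have hp : ∀ x, f x ^ p = 0 := fun x => by
    refine pow_eq_zero_of_le (Fact.out : p.Prime).two_le ?_
    rw [hf, sq, TrivSqZeroExt.inr_mul_inr]
  have h := congrArg (UniversalEnvelopingAlgebra.lift F f)
    (RestrictedLieAlgebra.pOp_add (p := p) (F := F) x y)
  rw [← map_add] at h
  simp only [map_sub, map_pow, UniversalEnvelopingAlgebra.lift_ι_apply, hp, sub_zero] at h
  rw [hf, hf, hf, ← TrivSqZeroExt.inr_sub, ← TrivSqZeroExt.inr_sub, ← map_sub, ← map_sub,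
    ← TrivSqZeroExt.inr_zero] at h
  exact (Submodule.Quotient.mk_eq_zero _).mp (TrivSqZeroExt.inr_injective h)

section Ideals

variable (L)

/-- The subspace `L'_p u(L)` of `u(L)`. -/
noncomputable def derivedPIdeal : Submodule F (uEnv p F L) :=
  ((derivedP p F L).map (uemb p F L)) * (⊤ : Submodule F (uEnv p F L))

variable {L}

theorem uemb_mul_mem_derivedPIdeal {y : L} (hy : y ∈ derivedP p F L) (v : uEnv p F L) :
    uemb p F L y * v ∈ derivedPIdeal p F L :=
  Submodule.mul_mem_mul (Submodule.mem_map_of_mem hy) Submodule.mem_top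

theorem uemb_mem_derivedPIdeal {y : L} (hy : y ∈ derivedP p F L) :
    uemb p F L y ∈ derivedPIdeal p F L := by
  simpa using uemb_mul_mem_derivedPIdeal p F hy 1

theorem derivedPIdeal_induction {S : Submodule F (uEnv p F L)}
    (h : ∀ y ∈ derivedP p F L, ∀ v, uemb p F L y * v ∈ S) : derivedPIdeal p F L ≤ S := by
  refine Submodule.mul_le.mpr ?_
  rintro _ ⟨y, hy, rfl⟩ v -
  exact h y hy v

theorem mul_mem_derivedPIdeal_right {z : uEnv p F L} (hz : z ∈ derivedPIdeal p F L)
    (w : uEnv p F L) : z * w ∈ derivedPIdeal p F L := by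
  have h : derivedPIdeal p F L
      ≤ (derivedPIdeal p F L).comap (LinearMap.mulRight F w) :=
    derivedPIdeal_induction p F fun y hy v => by
      simpa [mul_assoc] using uemb_mul_mem_derivedPIdeal p F hy (v * w)
  exact h hz

theorem mul_mem_derivedPIdeal_left (w : uEnv p F L) {z : uEnv p F L}
    (hz : z ∈ derivedPIdeal p F L) : w * z ∈ derivedPIdeal p F L := by
  have hw : w ∈ Algebra.adjoin F (Set.range (uemb p F L)) :=
    adjoin_range_uemb p F L ▸ Algebra.mem_top
  induction hw using Algebra.adjoin_induction generalizing z with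
  | mem w hw =>
    obtain ⟨x, rfl⟩ := hw
    have h : derivedPIdeal p F L
        ≤ (derivedPIdeal p F L).comap (LinearMap.mulLeft F (uemb p F L x)) :=
      derivedPIdeal_induction p F fun y hy v => by
        have hxy : uemb p F L x * (uemb p F L y * v)
            = uemb p F L ⁅x, y⁆ * v + uemb p F L y * (uemb p F L x * v) := by
          rw [uemb_lie]
          noncomm_ring
        rw [Submodule.mem_comap, LinearMap.mulLeft_apply, hxy]
        exact add_mem (uemb_mul_mem_derivedPIdeal p F (lie_mem_derivedP p F x y) v)
          (uemb_mul_mem_derivedPIdeal p F hy _)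
    exact h hz
  | algebraMap r =>
    rw [← Algebra.smul_def]
    exact Submodule.smul_mem _ _ hz
  | add a b _ _ ha hb =>
    rw [add_mul]
    exact add_mem (ha hz) (hb hz)
  | mul a b _ _ ha hb =>
    rw [mul_assoc]
    exact ha (hb hz)

/-- An algebra homomorphism killing `L'_p` kills the ideal it generates. -/
theorem map_eq_zero_of_mem_derivedPIdeal {C : Type*} [Ring C] [Algebra F C]
    (χ : uEnv p F L →ₐ[F] C) (hχ : ∀ y ∈ derivedP p F L, χ (uemb p F L y) = 0)
    {z : uEnv p F L} (hz : z ∈ derivedPIdeal p F L) : χ z = 0 :=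
  derivedPIdeal_induction (S := LinearMap.ker χ.toLinearMap) p F
    (fun y hy v => by simp [hχ y hy]) hz

variable [Fact p.Prime]

theorem aug_uemb (x : L) : aug p F L (uemb p F L x) = 0 := by
  simp only [aug, uemb, LinearMap.comp_apply, LieHom.coe_toLinearMap, AlgHom.toLinearMap_apply,
    RingQuot.liftAlgHom_mkAlgHom_apply, UniversalEnvelopingAlgebra.lift_ι_apply]
  rfl

theorem mem_omegaIdeal {z : uEnv p F L} : z ∈ omegaIdeal p F L ↔ aug p F L z = 0 := Iff.rfl

theorem jIdeal_le_derivedPIdeal : jIdeal p F L ≤ derivedPIdeal p F L := by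
  refine sup_le (Submodule.mul_le.mpr ?_) (Submodule.mul_le.mpr ?_)
  · rintro w - _ ⟨y, hy, rfl⟩
    exact mul_mem_derivedPIdeal_left p F w
      (uemb_mem_derivedPIdeal p F (derivedSub_le_derivedP p F hy))
  · rintro _ ⟨y, hy, rfl⟩ w -
    exact uemb_mul_mem_derivedPIdeal p F (derivedSub_le_derivedP p F hy) w

theorem uemb_mul_mem_jIdeal {y : L} (hy : y ∈ derivedP p F L) {w : uEnv p F L}
    (hw : w ∈ omegaIdeal p F L) : uemb p F L y * w ∈ jIdeal p F L := by
  have hder : ∀ x ∈ derivedSub F L, ∀ w ∈ omegaIdeal p F L,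
      uemb p F L x * w ∈ jIdeal p F L := fun x hx w hw =>
    Submodule.mem_sup_right (Submodule.mul_mem_mul (Submodule.mem_map_of_mem hx) hw)
  let K : LieSubalgebra F L :=
    { carrier := {x | ∀ w ∈ omegaIdeal p F L, uemb p F L x * w ∈ jIdeal p F L}
      add_mem' := fun {a b} ha hb w hw => by
        rw [map_add, add_mul]
        exact add_mem (ha w hw) (hb w hw)
      zero_mem' := fun w _ => by simp
      smul_mem' := fun c x hx w hw => by
        rw [map_smul, smul_mul_assoc]
        exact Submodule.smul_mem _ _ (hx w hw)
      lie_mem' := fun {x y} _ _ => hder _ (lie_mem_derivedSub F x y) }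
  refine (mem_derivedP_iff p F).mp hy K hder (fun x hx w hw => ?_) w hw
  obtain ⟨k, hk⟩ := Nat.exists_eq_succ_of_ne_zero (Fact.out : p.Prime).ne_zero
  have hpow : uemb p F L (pmap p F L x) = uemb p F L x * uemb p F L x ^ k := by
    rw [uemb_pmap, ← pow_succ', ← Nat.succ_eq_add_one, ← hk]
  rw [hpow, mul_assoc]
  refine hx _ ?_
  rw [mem_omegaIdeal] at hw ⊢
  rw [map_mul, hw, mul_zero]

theorem derivedPIdeal_le : derivedPIdeal p F L ≤ lSub p F L ⊔ jIdeal p F L :=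
  derivedPIdeal_induction p F fun y hy v => by
    have hv : uemb p F L y * v = uemb p F L (aug p F L v • y)
        + uemb p F L y * (v - algebraMap F _ (aug p F L v)) := by
      rw [map_smul, mul_sub, ← Algebra.commutes, ← Algebra.smul_def]
      abel
    rw [hv]
    refine Submodule.add_mem_sup ⟨_, rfl⟩ (uemb_mul_mem_jIdeal p F hy ?_)
    rw [mem_omegaIdeal, map_sub, AlgHom.commutes, Algebra.algebraMap_self_apply, sub_self]

theorem jIdeal_le_omegaIdeal : jIdeal p F L ≤ omegaIdeal p F L := by
  refine sup_le (Submodule.mul_le.mpr ?_) (Submodule.mul_le.mpr ?_)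
  · rintro w - _ ⟨y, -, rfl⟩
    rw [mem_omegaIdeal, map_mul, aug_uemb, mul_zero]
  · rintro _ ⟨y, -, rfl⟩ w -
    rw [mem_omegaIdeal, map_mul, aug_uemb, zero_mul]

end Ideals

end Enveloping

/-- The quotient `u(L) / L'_p u(L)` is a commutative algebra. -/
theorem exists_commRing_quotient.{u, v} (p : ℕ) (F : Type u) (L : Type v) [Field F]
    [LieRing L] [LieAlgebra F L] [RestrictedLieAlgebra p F L] :
    ∃ (A : Type (max u v)) (_ : CommRing A) (_ : Algebra F A) (π : uEnv p F L →ₐ[F] A),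
      Function.Surjective π ∧ ∀ z, π z = 0 ↔ z ∈ derivedPIdeal p F L := by
  let I : Ideal (uEnv p F L) :=
    { (derivedPIdeal p F L).toAddSubmonoid with
      smul_mem' := fun w _ hz => mul_mem_derivedPIdeal_left p F w hz }
  have : I.IsTwoSided := ⟨fun w hz => mul_mem_derivedPIdeal_right p F hz w⟩
  let π := Ideal.Quotient.mkₐ F I
  have hsurj : Function.Surjective π := Ideal.Quotient.mkₐ_surjective F I
  have hker : ∀ z, π z = 0 ↔ z ∈ derivedPIdeal p F L := fun z =>
    Ideal.Quotient.eq_zero_iff_mem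
  have hgen : Algebra.adjoin F (π '' Set.range (uemb p F L)) = ⊤ := by
    rw [← AlgHom.map_adjoin, adjoin_range_uemb, Algebra.map_top, AlgHom.range_eq_top]
    exact hsurj
  have hcomm : ∀ a b : uEnv p F L ⧸ I, a * b = b * a := by
    intro a b
    refine Algebra.commute_of_mem_adjoin_of_forall_mem_commute
      (hgen ▸ Algebra.mem_top : b ∈ Algebra.adjoin F (π '' Set.range (uemb p F L))) ?_
    rintro _ ⟨_, ⟨y, rfl⟩, rfl⟩
    refine (Algebra.commute_of_mem_adjoin_of_forall_mem_commute
      (hgen ▸ Algebra.mem_top : a ∈ Algebra.adjoin F (π '' Set.range (uemb p F L))) ?_).symm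
    rintro _ ⟨_, ⟨x, rfl⟩, rfl⟩
    rw [Commute, SemiconjBy, ← sub_eq_zero, ← map_mul π, ← map_mul π, ← map_sub π, ← uemb_lie, hker]
    exact uemb_mem_derivedPIdeal p F (lie_mem_derivedP p F y x)
  let commRing : CommRing (uEnv p F L ⧸ I) :=
    { (inferInstance : Ring (uEnv p F L ⧸ I)) with mul_comm := hcomm }
  exact ⟨uEnv p F L ⧸ I, commRing, inferInstance, π, hsurj, hker⟩

section Monomials

variable (p : ℕ) (F : Type*) [Field F]
variable (L : Type*) [LieRing L] [LieAlgebra F L] [RestrictedLieAlgebra p F L]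
variable {n : ℕ} {ex : Fin n → ℕ}

/-- The ordered monomial with exponents `a` in the family `X`. -/
noncomputable def pbwMonomial (X : (i : Fin n) → Fin (ex i) → L)
    (a : (i : Fin n) → Fin (ex i) → ℕ) : uEnv p F L :=
  ((List.finRange n).map (fun i =>
    ((List.finRange (ex i)).map (fun j => uemb p F L (X i j) ^ a i j)).prod)).prod

/-- The exponents of the degree one monomial `X i j`. -/
def unitExp (i : Fin n) (j : Fin (ex i)) : (k : Fin n) → Fin (ex k) → ℕ := fun k l =>
  if (⟨k, l⟩ : Σ k, Fin (ex k)) = ⟨i, j⟩ then 1 else 0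

theorem sum_unitExp (i : Fin n) (j : Fin (ex i)) : ∑ k, ∑ l, unitExp i j k l = 1 := by
  rw [← Fintype.sum_sigma' fun k l => unitExp i j k l]
  simp [unitExp]

theorem eq_zero_or_eq_unitExp_or_two_le (a : (i : Fin n) → Fin (ex i) → ℕ) :
    a = 0 ∨ (∃ i j, a = unitExp i j) ∨ 2 ≤ ∑ i, ∑ j, a i j := by
  rcases Nat.lt_or_ge (∑ i, ∑ j, a i j) 2 with h | h
  · rw [← Fintype.sum_sigma' fun k l => a k l] at h
    rcases Nat.le_one_iff_eq_zero_or_eq_one.mp (Nat.lt_succ_iff.mp h) with h | h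
    · left
      funext i j
      exact Finset.sum_eq_zero_iff.mp h ⟨i, j⟩ (Finset.mem_univ _)
    · right; left
      let d : (Σ i, Fin (ex i)) →₀ ℕ := Finsupp.equivFunOnFinite.symm fun q => a q.1 q.2
      have hd : d.sum (fun _ m => m) = 1 := by
        rw [Finsupp.sum_fintype _ _ fun _ => rfl]
        exact h
      obtain ⟨⟨i, j⟩, hq⟩ := (Finsupp.sum_eq_one_iff d).mp hd
      refine ⟨i, j, ?_⟩
      funext k l
      have hkl := DFunLike.congr_fun hq ⟨k, l⟩
      rw [Finsupp.single_apply] at hkl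
      simp only [eq_comm (a := (⟨i, j⟩ : Σ k, Fin (ex k)))] at hkl
      exact hkl
  · exact .inr (.inr h)

variable {L}

theorem pbwMonomial_zero (X : (i : Fin n) → Fin (ex i) → L) : pbwMonomial p F L X 0 = 1 := by
  simp [pbwMonomial]

variable {C : Type*} [CommRing C] [Algebra F C] (χ : uEnv p F L →ₐ[F] C)

theorem map_pbwMonomial (X : (i : Fin n) → Fin (ex i) → L)
    (a : (i : Fin n) → Fin (ex i) → ℕ) :
    χ (pbwMonomial p F L X a) = ∏ i, ∏ j, χ (uemb p F L (X i j)) ^ a i j := by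
  simp only [pbwMonomial, map_list_prod, List.map_map, Function.comp_def, map_pow,
    Fin.prod_univ_def]

theorem map_pbwMonomial_unitExp (X : (i : Fin n) → Fin (ex i) → L) (i : Fin n)
    (j : Fin (ex i)) :
    χ (pbwMonomial p F L X (unitExp i j)) = χ (uemb p F L (X i j)) := by
  rw [map_pbwMonomial, ← Fintype.prod_sigma' fun k l => χ (uemb p F L (X k l)) ^ unitExp i j k l]
  simp [unitExp, pow_ite]

theorem map_eq_of_sub_mem_derivedP (hχ : ∀ y ∈ derivedP p F L, χ (uemb p F L y) = 0) {x y : L}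
    (h : x - y ∈ derivedP p F L) : χ (uemb p F L x) = χ (uemb p F L y) := by
  rw [← sub_eq_zero, ← map_sub χ, ← map_sub, hχ _ h]

theorem map_pbwMonomial_eq_prod_pow (hχ : ∀ y ∈ derivedP p F L, χ (uemb p F L y) = 0)
    {e : Fin n → L} {X : (i : Fin n) → Fin (ex i) → L}
    (hX : ∀ i (j : Fin (ex i)), X i j - (pmap p F L)^[(j : ℕ)] (e i) ∈ derivedP p F L)
    (a : (i : Fin n) → Fin (ex i) → Fin p) :
    χ (pbwMonomial p F L X fun i j => a i j)
      = ∏ i, χ (uemb p F L (e i)) ^ (finFunctionFinEquiv (a i) : ℕ) := by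
  rw [map_pbwMonomial]
  refine Finset.prod_congr rfl fun i _ => ?_
  rw [finFunctionFinEquiv_apply, ← Finset.prod_pow_eq_pow_sum]
  refine Finset.prod_congr rfl fun j _ => ?_
  rw [map_eq_of_sub_mem_derivedP p F χ hχ (hX i j), uemb_pmap_iterate, map_pow, ← pow_mul,
    mul_comm]

end Monomials

section Presentation

variable (p : ℕ) (F : Type*) [Field F]
variable {L : Type*} [LieRing L] [LieAlgebra F L] [RestrictedLieAlgebra p F L]
variable {n : ℕ} {e : Fin n → L} {ex : Fin n → ℕ} {X : (i : Fin n) → Fin (ex i) → L}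

/-- A subspace of `L` containing `L'_p` and all iterated `p`-th powers of the `e i` is `L`. -/
theorem GoodPresentation.mem_of_le (h : GoodPresentation p F L n e ex X) {S : Submodule F L}
    (hS : derivedP p F L ≤ S)
    (he : ∀ i (j : Fin (ex i)), (pmap p F L)^[(j : ℕ)] (e i) ∈ S) (x : L) : x ∈ S := by
  have hmap : S.map (derivedP p F L).mkQ = ⊤ := by
    rw [eq_top_iff, ← h.2.1, Submodule.span_le]
    rintro _ ⟨q, rfl⟩
    exact ⟨_, he q.1 q.2, rfl⟩
  obtain ⟨y, hy, hyx⟩ := (hmap ▸ Submodule.mem_top :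
    (derivedP p F L).mkQ x ∈ S.map (derivedP p F L).mkQ)
  rw [← sub_sub_cancel y x]
  exact sub_mem hy (hS ((Submodule.Quotient.eq _).mp hyx))

/-- The truncated monomials in `X` span `u(L)` modulo `L'_p u(L)`. -/
theorem GoodPresentation.span_pbwMonomial_sup (h : GoodPresentation p F L n e ex X) :
    Submodule.span F (Set.range fun a : (i : Fin n) → Fin (ex i) → Fin p =>
      pbwMonomial p F L X fun i j => a i j) ⊔ derivedPIdeal p F L = ⊤ := by
  obtain ⟨A, _, _, π, hsurj, hker⟩ := exists_commRing_quotient p F L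
  have hπ : ∀ y ∈ derivedP p F L, π (uemb p F L y) = 0 := fun y hy =>
    (hker _).mpr (uemb_mem_derivedPIdeal p F hy)
  have hgen : Algebra.adjoin F (Set.range fun i => π (uemb p F L (e i))) = ⊤ := by
    let T := Algebra.adjoin F (Set.range fun i => π (uemb p F L (e i)))
    have hT : ∀ x, π (uemb p F L x) ∈ T := by
      refine h.mem_of_le p F
        (S := (Subalgebra.toSubmodule T).comap (π.toLinearMap.comp (uemb p F L)))
        (fun y hy => ?_) fun i j => ?_
      · change π (uemb p F L y) ∈ T
        rw [hπ y hy]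
        exact zero_mem _
      · change π (uemb p F L _) ∈ T
        rw [uemb_pmap_iterate, map_pow]
        exact pow_mem (Algebra.subset_adjoin (Set.mem_range_self i)) _
    rw [eq_top_iff, ← (AlgHom.range_eq_top π).mpr hsurj, ← Algebra.map_top,
      ← adjoin_range_uemb, AlgHom.map_adjoin, Algebra.adjoin_le_iff]
    rintro _ ⟨_, ⟨x, rfl⟩, rfl⟩
    exact hT x
  have hpow : ∀ i, π (uemb p F L (e i)) ^ p ^ ex i = 0 := fun i => by
    rw [← map_pow, ← uemb_pmap_iterate, hπ _ (h.2.2.1 i)]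
  rw [eq_top_iff]
  rintro z -
  have hz : π z ∈ (Submodule.span F (Set.range fun a : (i : Fin n) → Fin (ex i) → Fin p =>
      pbwMonomial p F L X fun i j => a i j)).map π.toLinearMap := by
    have hspan := span_truncated_monomials_eq_top _ _ hpow hgen
    rw [Submodule.map_span, ← Set.range_comp]
    refine Submodule.span_mono ?_ (hspan ▸ Submodule.mem_top : π z ∈ _)
    rintro _ ⟨d, rfl⟩
    refine ⟨fun i => finFunctionFinEquiv.symm (d i), ?_⟩
    refine (map_pbwMonomial_eq_prod_pow p F π hπ h.2.2.2 _).trans ?_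
    simp only [Equiv.apply_symm_apply]
  obtain ⟨m, hm, hmz⟩ := hz
  rw [← add_sub_cancel m z]
  refine Submodule.add_mem_sup hm ((hker _).mp ?_)
  rw [map_sub, sub_eq_zero]
  exact hmz.symm

variable [Fact p.Prime]

/-- `u(L)` maps to the truncated polynomial algebra `u(L/L'_p)`. -/
theorem GoodPresentation.exists_truncPoly_algHom [CharP F p]
    (h : GoodPresentation p F L n e ex X) :
    ∃ ψ : uEnv p F L →ₐ[F] TruncPoly F fun i => p ^ ex i,
      (∀ y ∈ derivedP p F L, ψ (uemb p F L y) = 0) ∧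
      ∀ i, ψ (uemb p F L (e i)) = truncX F (fun i => p ^ ex i) i := by
  have hp : p.Prime := Fact.out
  let B := TruncPoly F fun i => p ^ ex i
  let t : Fin n → B := truncX F fun i => p ^ ex i
  have : Nontrivial B := ⟨_, 0, (linearIndependent_truncX_monomials (F := F)
    fun i => p ^ ex i).ne_zero fun i => ⟨0, pow_pos hp.pos _⟩⟩
  have : CharP B p := charP_of_injective_algebraMap (algebraMap F B).injective p
  let b := Module.Basis.mk h.1 h.2.1.ge
  let f : L →ₗ[F] B :=
    (b.constr F fun q => t q.1 ^ p ^ (q.2 : ℕ)).comp (derivedP p F L).mkQ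
  have hfder : ∀ y ∈ derivedP p F L, f y = 0 := fun y hy => by
    have hy : (derivedP p F L).mkQ y = 0 := (Submodule.Quotient.mk_eq_zero _).mpr hy
    rw [LinearMap.comp_apply, hy, map_zero]
  have hfe : ∀ i (j : ℕ), j ≤ ex i → f ((pmap p F L)^[j] (e i)) = t i ^ p ^ j := by
    intro i j hj
    rcases hj.lt_or_eq with hj | rfl
    · have hb : (derivedP p F L).mkQ ((pmap p F L)^[j] (e i)) = b ⟨i, ⟨j, hj⟩⟩ := by
        rw [Module.Basis.mk_apply]
        rfl
      rw [LinearMap.comp_apply, hb, Module.Basis.constr_basis]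
    · rw [hfder _ (h.2.2.1 i)]
      exact (truncX_pow (fun i => p ^ ex i) i).symm
  have hfp : ∀ x, f (pmap p F L x) = f x ^ p := by
    let S : Submodule F L :=
      { carrier := {x | f (pmap p F L x) = f x ^ p}
        add_mem' := fun {x y} hx hy => by
          have hxy := hfder _ (pmap_add_sub_mem_derivedP p F x y)
          rw [map_sub, map_sub, sub_sub, sub_eq_zero] at hxy
          rw [Set.mem_ofPred_eq, hxy, map_add, add_pow_char, hx, hy]
        zero_mem' := by
          have h0 : pmap p F L 0 = 0 := by
            have h0 := pOp_smul (p := p) (0 : F) (0 : L)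
            rwa [zero_smul, zero_pow hp.ne_zero, zero_smul] at h0
          rw [Set.mem_ofPred_eq, h0, map_zero, zero_pow hp.ne_zero]
        smul_mem' := fun c x hx => by
          rw [Set.mem_ofPred_eq, pmap, pOp_smul, map_smul, map_smul, smul_pow, ← hx] }
    refine h.mem_of_le p F (S := S) (fun y hy => ?_) fun i j => ?_
    · change f (pmap p F L y) = f y ^ p
      rw [hfder y hy, hfder _ (pmap_mem_derivedP p F hy), zero_pow hp.ne_zero]
    · change f (pmap p F L _) = f _ ^ p
      rw [← Function.iterate_succ_apply' (pmap p F L), hfe i j j.isLt.le,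
        hfe i (j + 1) j.isLt, ← pow_mul, pow_succ]
  let g : L →ₗ⁅F⁆ B :=
    { f with
      map_lie' := fun {x y} => by
        change f ⁅x, y⁆ = ⁅f x, f y⁆
        rw [hfder _ (lie_mem_derivedP p F x y), LieRing.of_associative_ring_bracket, mul_comm,
          sub_self] }
  let ψ : uEnv p F L →ₐ[F] B :=
    RingQuot.liftAlgHom F ⟨UniversalEnvelopingAlgebra.lift F g, by
      rintro a b ⟨x, rfl, rfl⟩
      rw [map_pow, UniversalEnvelopingAlgebra.lift_ι_apply,
        UniversalEnvelopingAlgebra.lift_ι_apply]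
      exact (hfp x).symm⟩
  have hψ : ∀ x, ψ (uemb p F L x) = f x := fun x => by
    simp only [ψ, uemb, LinearMap.comp_apply, LieHom.coe_toLinearMap, AlgHom.toLinearMap_apply,
      RingQuot.liftAlgHom_mkAlgHom_apply, UniversalEnvelopingAlgebra.lift_ι_apply]
    rfl
  refine ⟨ψ, fun y hy => (hψ y).trans (hfder y hy), fun i => (hψ _).trans ?_⟩
  simpa using hfe i 0 (Nat.zero_le _)

/-- Every monomial exponent in the definition of `E` comes from a family of digits. -/
theorem eSpace_eq : eSpace p F L n ex X = jIdeal p F L ⊔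
    Submodule.span F ((fun a : (i : Fin n) → Fin (ex i) → Fin p =>
      pbwMonomial p F L X fun i j => a i j) '' {a | 2 ≤ ∑ i, ∑ j, (a i j : ℕ)}) := by
  rw [eSpace]
  congr 2
  ext u
  constructor
  · rintro ⟨a, ha, hdeg, rfl⟩
    exact ⟨fun i j => ⟨a i j, ha i j⟩, hdeg, rfl⟩
  · rintro ⟨a, hdeg, rfl⟩
    exact ⟨fun i j => a i j, fun i j => (a i j).isLt, hdeg, rfl⟩

theorem lSub_sup_eSpace_le_omegaIdeal :
    lSub p F L ⊔ eSpace p F L n ex X ≤ omegaIdeal p F L := by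
  refine sup_le ?_ ?_
  · rintro _ ⟨x, rfl⟩
    exact (mem_omegaIdeal p F).mpr (aug_uemb p F x)
  · rw [eSpace_eq]
    refine sup_le (jIdeal_le_omegaIdeal p F) (Submodule.span_le.mpr ?_)
    rintro _ ⟨a, ha, rfl⟩
    rw [SetLike.mem_coe, mem_omegaIdeal, map_pbwMonomial]
    obtain ⟨i, -, hi⟩ := Finset.exists_ne_zero_of_sum_ne_zero (Nat.ne_of_gt (two_pos.trans_le ha))
    obtain ⟨j, -, hj⟩ := Finset.exists_ne_zero_of_sum_ne_zero hi
    refine Finset.prod_eq_zero (Finset.mem_univ i) (Finset.prod_eq_zero (Finset.mem_univ j) ?_)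
    rw [aug_uemb, zero_pow hj]

theorem GoodPresentation.omegaIdeal_eq (h : GoodPresentation p F L n e ex X) :
    omegaIdeal p F L = lSub p F L ⊔ eSpace p F L n ex X := by
  refine le_antisymm (fun z hz => ?_) (lSub_sup_eSpace_le_omegaIdeal p F)
  have hN : derivedPIdeal p F L ≤ lSub p F L ⊔ eSpace p F L n ex X :=
    (derivedPIdeal_le p F).trans (sup_le_sup_left le_sup_left _)
  have htop : (1 : Submodule F (uEnv p F L)) ⊔ (lSub p F L ⊔ eSpace p F L n ex X) = ⊤ := by
    rw [eq_top_iff, ← h.span_pbwMonomial_sup p F]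
    refine sup_le (Submodule.span_le.mpr ?_) (hN.trans le_sup_right)
    rintro _ ⟨a, rfl⟩
    rcases eq_zero_or_eq_unitExp_or_two_le (fun i j => (a i j : ℕ)) with ha | ⟨i, j, ha⟩ | ha
    · dsimp only
      rw [ha, pbwMonomial_zero]
      exact Submodule.mem_sup_left (Submodule.one_le.mp le_rfl)
    · obtain ⟨A, _, _, π, -, hker⟩ := exists_commRing_quotient p F L
      dsimp only
      rw [ha, ← add_sub_cancel (uemb p F L (X i j)) (pbwMonomial p F L X _)]
      refine Submodule.mem_sup_right
        (add_mem (Submodule.mem_sup_left ⟨_, rfl⟩) (hN ((hker _).mp ?_)))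
      rw [map_sub, map_pbwMonomial_unitExp, sub_self]
    · refine Submodule.mem_sup_right (Submodule.mem_sup_right ?_)
      rw [eSpace_eq]
      exact Submodule.mem_sup_right (Submodule.subset_span ⟨a, ha, rfl⟩)
  obtain ⟨c, hc, w, hw, rfl⟩ := Submodule.mem_sup.mp (htop ▸ Submodule.mem_top : z ∈ _)
  obtain ⟨c, rfl⟩ := Submodule.mem_one.mp hc
  have hw0 := (mem_omegaIdeal p F).mp (lSub_sup_eSpace_le_omegaIdeal p F hw)
  rw [mem_omegaIdeal, map_add, hw0, add_zero, AlgHom.commutes, Algebra.algebraMap_self_apply] at hz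
  rwa [hz, map_zero, zero_add]

theorem GoodPresentation.inf_eSpace_le [CharP F p] (h : GoodPresentation p F L n e ex X) :
    (lSub p F L ⊔ derivedPIdeal p F L) ⊓ eSpace p F L n ex X ≤ jIdeal p F L := by
  have hp : p.Prime := Fact.out
  obtain ⟨ψ, hψ, hψe⟩ := h.exists_truncPoly_algHom p F
  let mono : ((i : Fin n) → Fin (ex i) → Fin p) → uEnv p F L := fun a =>
    pbwMonomial p F L X fun i j => a i j
  have hli : LinearIndependent F (ψ.toLinearMap ∘ mono) := by
    have hli := (linearIndependent_truncX_monomials (F := F) fun i => p ^ ex i).comp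
      (Equiv.piCongrRight fun i : Fin n => finFunctionFinEquiv (m := p) (n := ex i))
      (Equiv.injective _)
    convert hli using 1
    funext a
    refine (map_pbwMonomial_eq_prod_pow p F ψ hψ h.2.2.2 a).trans ?_
    simp only [hψe]
    rfl
  let S := Submodule.span F ((ψ.toLinearMap ∘ mono) '' {a | ∑ i, ∑ j, (a i j : ℕ) = 1})
  have hL : ∀ x, ψ (uemb p F L x) ∈ S := by
    refine h.mem_of_le p F (S := S.comap (ψ.toLinearMap.comp (uemb p F L)))
      (fun y hy => ?_) fun i j => ?_
    · change ψ (uemb p F L y) ∈ S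
      rw [hψ y hy]
      exact zero_mem _
    · change ψ (uemb p F L _) ∈ S
      rw [← map_eq_of_sub_mem_derivedP p F ψ hψ (h.2.2.2 i j), ← map_pbwMonomial_unitExp]
      refine Submodule.subset_span ⟨fun k l => ⟨unitExp i j k l, ?_⟩, sum_unitExp i j, rfl⟩
      have := hp.two_le
      unfold unitExp
      split <;> omega
  rintro z ⟨hz, hzE⟩
  rw [SetLike.mem_coe] at hz hzE
  rw [eSpace_eq] at hzE
  obtain ⟨w, hw, m, hm, rfl⟩ := Submodule.mem_sup.mp hzE
  have hψw : ψ w = 0 :=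
    map_eq_zero_of_mem_derivedPIdeal p F ψ hψ (jIdeal_le_derivedPIdeal p F hw)
  have hm1 : ψ m ∈ S := by
    obtain ⟨_, ⟨x, rfl⟩, v, hv, hxv⟩ := Submodule.mem_sup.mp hz
    have hψv := congrArg ψ hxv
    rw [map_add, map_add, hψw, zero_add, map_eq_zero_of_mem_derivedPIdeal p F ψ hψ hv,
      add_zero] at hψv
    exact hψv ▸ hL x
  have hm2 : ψ m ∈ Submodule.span F
      ((ψ.toLinearMap ∘ mono) '' {a | 2 ≤ ∑ i, ∑ j, (a i j : ℕ)}) := by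
    rw [Set.image_comp, ← Submodule.map_span]
    exact ⟨m, hm, rfl⟩
  have hdisj : Disjoint {a : (i : Fin n) → Fin (ex i) → Fin p | ∑ i, ∑ j, (a i j : ℕ) = 1}
      {a | 2 ≤ ∑ i, ∑ j, (a i j : ℕ)} := by
    rw [Set.disjoint_left]
    intro a h1 h2
    rw [Set.mem_ofPred_eq] at h1 h2
    omega
  have hψm : ψ m = 0 := Submodule.disjoint_def.mp (hli.disjoint_span_image hdisj) _ hm1 hm2
  have hm0 : m = 0 := Submodule.disjoint_def.mp (Submodule.range_ker_disjoint hli) m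
    (Submodule.span_mono (Set.image_subset_range _ _) hm) hψm
  rwa [hm0, add_zero]

end Presentation

end RestrictedLieAlgebra

open RestrictedLieAlgebra in
/-- With `X` and `E` as in the running setup: (1) `ω(L) = L + E`;
(2) `(L + J_L) ∩ E = J_L = E ∩ L'_p u(L)`;
(3) `ω(L)/J_L = (L + J_L)/J_L ⊕ E/J_L`. -/
theorem omega_decomposition
    (p : ℕ) (F L : Type*) [Field F] [Fact p.Prime] [CharP F p] [PerfectField F]
    [LieRing L] [LieAlgebra F L] [RestrictedLieAlgebra p F L]
    [FiniteDimensional F L] (hL : IsPNilpotent p F L)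
    (n : ℕ) (e : Fin n → L) (ex : Fin n → ℕ) (X : (i : Fin n) → Fin (ex i) → L)
    (hpres : GoodPresentation p F L n e ex X) :
    omegaIdeal p F L = lSub p F L ⊔ eSpace p F L n ex X ∧
    ((lSub p F L ⊔ jIdeal p F L) ⊓ eSpace p F L n ex X = jIdeal p F L ∧
      jIdeal p F L
        = eSpace p F L n ex X ⊓
            (((derivedP p F L).map (uemb p F L)) * (⊤ : Submodule F (uEnv p F L)))) ∧
    (Disjoint ((lSub p F L ⊔ jIdeal p F L).map (jIdeal p F L).mkQ)
        ((eSpace p F L n ex X).map (jIdeal p F L).mkQ) ∧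
      ((lSub p F L ⊔ jIdeal p F L).map (jIdeal p F L).mkQ ⊔
          (eSpace p F L n ex X).map (jIdeal p F L).mkQ)
        = (omegaIdeal p F L).map (jIdeal p F L).mkQ) := by
  have hJE : jIdeal p F L ≤ eSpace p F L n ex X := le_sup_left
  have hJN : jIdeal p F L ≤ derivedPIdeal p F L := jIdeal_le_derivedPIdeal p F
  have hω := hpres.omegaIdeal_eq p F
  have hle := hpres.inf_eSpace_le p F
  have hinf : (lSub p F L ⊔ jIdeal p F L) ⊓ eSpace p F L n ex X = jIdeal p F L :=
    le_antisymm ((inf_le_inf_right _ (sup_le_sup_left hJN _)).trans hle)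
      (le_inf le_sup_right hJE)
  refine ⟨hω, ⟨hinf, ?_⟩, ?_, ?_⟩
  · refine le_antisymm (le_inf hJE hJN) (le_trans ?_ hle)
    rw [inf_comm]
    exact inf_le_inf_right _ le_sup_right
  · rw [Submodule.disjoint_def]
    rintro _ ⟨x, hx, rfl⟩ ⟨y, hy, hxy⟩
    have hsub : y - x ∈ jIdeal p F L := (Submodule.Quotient.eq _).mp hxy
    have hxE : x ∈ eSpace p F L n ex X := by
      rw [← sub_sub_cancel y x]
      exact sub_mem hy (hJE hsub)
    exact (Submodule.Quotient.mk_eq_zero _).mpr (hinf ▸ ⟨hx, hxE⟩)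
  · rw [← Submodule.map_sup, hω, sup_assoc, sup_eq_right.mpr hJE]
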